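/- Let P = P_{n,r} be the poset of r-colored injective words and let S = {s_1 < ⋯ < s_k} ⊆ {1,…,n−1}. Then b_P(S), the dimension of β_P(S), is equal to the number of pairs (w,u) where w ∈ 𝔖_n has descent set S, u is an r-colored permutation in 𝔖_n[ℤ_r], and τ(w,u) is odd. -/

import Mathlib

open scoped Classical

noncomputable section

/-! ### Permutation combinatorics -/

/-- The value `w(i)` (1-based, in `{1,…,n}`) of a permutation `w` of `{1,…,n}`,
realized as `Equiv.Perm (Fin n)`. -/
def permApp {n : ℕ} (w : Equiv.Perm (Fin n)) (i : ℕ) : ℕ :=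
  if h : i - 1 < n then (w ⟨i - 1, h⟩ : ℕ) + 1 else 0

/-- The descent set of a permutation, a subset of `{1,…,n-1}`. -/
def descentSet {n : ℕ} (w : Equiv.Perm (Fin n)) : Finset ℕ :=
  (Finset.Icc 1 (n - 1)).filter fun i => permApp w (i + 1) < permApp w i

/-- `numDescentSet m T` is the number of permutations in `𝔖_m` with descent set `T`. -/
def numDescentSet (m : ℕ) (T : Finset ℕ) : ℕ :=
  Nat.card {w : Equiv.Perm (Fin m) // descentSet w = T}

/-- The Coxeter length (number of inversions) of a permutation. -/
def invCount {n : ℕ} (w : Equiv.Perm (Fin n)) : ℕ :=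
  (Finset.univ.filter fun p : Fin n × Fin n => p.1 < p.2 ∧ w p.2 < w p.1).card

/-- For `S = {s_1 < s_2 < ⋯ < s_k} ⊆ {1,…,n-1}`, `sElt n S j = s_j`, with the
conventions `s_0 = 0` and `s_j = n` for `j > k`. -/
def sElt (n : ℕ) (S : Finset ℕ) (j : ℕ) : ℕ :=
  if j = 0 then 0 else if j ≤ S.card then (S.sort (· ≤ ·)).getD (j - 1) 0 else n

lemma sElt_of_gt (n : ℕ) (S : Finset ℕ) (j : ℕ) (h : S.card < j) : sElt n S j = n := by
  unfold sElt
  rw [if_neg (by omega), if_neg (by omega)]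

/-! ### Standard Young tableaux -/

/-- A standard Young tableau of shape `μ`: a filling of the cells of `μ` by the numbers
`1,…,μ.card`, each used once, strictly increasing along rows and columns
(the entry of a non-cell is `0`). -/
structure SYT (μ : YoungDiagram) where
  entry : ℕ → ℕ → ℕ
  entry_eq_zero : ∀ i j, (i, j) ∉ μ → entry i j = 0
  row_strict : ∀ i j1 j2, j1 < j2 → (i, j2) ∈ μ → entry i j1 < entry i j2
  col_strict : ∀ i1 i2 j, i1 < i2 → (i2, j) ∈ μ → entry i1 j < entry i2 j
  bijOn : Set.BijOn (fun p : ℕ × ℕ => entry p.1 p.2) ↑μ.cells ↑(Finset.Icc 1 μ.card)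

/-- The descent set of a standard Young tableau: those `k` such that `k+1` lies in a
strictly lower row than `k`. -/
def SYT.des {μ : YoungDiagram} (Q : SYT μ) : Finset ℕ :=
  (Finset.Icc 1 (μ.card - 1)).filter fun k =>
    ∃ p1 ∈ μ.cells, ∃ p2 ∈ μ.cells,
      Q.entry p1.1 p1.2 = k ∧ Q.entry p2.1 p2.2 = k + 1 ∧ p1.1 < p2.1

/-- `fSYTRow μ t` is the number of standard Young tableaux of shape `μ` whose first row
contains the numbers `1,…,t`. -/
def fSYTRow (μ : YoungDiagram) (t : ℕ) : ℕ :=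
  Nat.card {Q : SYT μ // ∀ k, 1 ≤ k → k ≤ t → ∃ j, (0, j) ∈ μ ∧ Q.entry 0 j = k}

/-! ### Irreducible characters of the symmetric group, via Jacobi–Trudi -/

/-- The number of functions `f : Fin n → Fin k` which are invariant under `g` and whose
fiber over `i` has `c i` elements.  For `c` a composition of `n`, the function
`g ↦ fixedYoungFns n k c g` is the character of the permutation representation of `𝔖_n`
on ordered set partitions of `{1,…,n}` of type `c`, i.e. of the representation induced
from the trivial representation of the corresponding Young subgroup. -/
def fixedYoungFns (n k : ℕ) (c : Fin k → ℤ) (g : Equiv.Perm (Fin n)) : ℕ :=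
  Nat.card {f : Fin n → Fin k //
    (∀ x, f (g x) = f x) ∧ ∀ i, ((Nat.card {x : Fin n // f x = i} : ℕ) : ℤ) = c i}

/-- The irreducible character `χ^μ` of `𝔖_n` associated to a partition `μ` of `n`
(encoded as a Young diagram with `n` cells), defined through the Jacobi–Trudi
determinantal formula `χ^μ = det (h_{μ_i - i + j})`. -/
def chi (n : ℕ) (μ : YoungDiagram) (g : Equiv.Perm (Fin n)) : ℤ :=
  ∑ σ : Equiv.Perm (Fin μ.rowLens.length),
    ((Equiv.Perm.sign σ : ℤˣ) : ℤ) *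
      (fixedYoungFns n μ.rowLens.length
        (fun i => ((μ.rowLen (i : ℕ) : ℕ) : ℤ) - ((i : ℕ) : ℤ) + ((σ i : ℕ) : ℤ)) g : ℤ)

/-! ### Posets, rank selection, maximal chains and characters -/

/-- The maximal chains of the subposet induced on a subset `A` of a poset. -/
def maxChainsIn {P : Type*} [Preorder P] (A : Set P) : Set (Set P) :=
  {C | C ⊆ A ∧ IsChain (· ≤ ·) C ∧
    ∀ D : Set P, D ⊆ A → IsChain (· ≤ ·) D → C ⊆ D → C = D}

/-- The rank-selected subposet `P_S = {x ∈ P : rk x ∈ S} ∪ {⊥, ⊤}`. -/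
def rankSel {P : Type*} [Preorder P] [OrderBot P] [OrderTop P] (rk : P → ℕ)
    (S : Finset ℕ) : Set P :=
  {x | rk x ∈ S} ∪ {⊥, ⊤}

/-- `a_P(S)`: the number of maximal chains of the rank-selected subposet `P_S`. -/
def chainCount {P : Type*} [Preorder P] [OrderBot P] [OrderTop P] (rk : P → ℕ)
    (S : Finset ℕ) : ℕ :=
  Set.ncard (maxChainsIn (rankSel rk S))

/-- `b_P(S) = Σ_{T ⊆ S} (-1)^{|S-T|} a_P(T)`. -/
def bDim {P : Type*} [Preorder P] [OrderBot P] [OrderTop P] (rk : P → ℕ)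
    (S : Finset ℕ) : ℤ :=
  ∑ T ∈ S.powerset, (-1 : ℤ) ^ (S.card - T.card) * (chainCount rk T : ℤ)

/-- The character of the permutation representation `α_P(S)` of a group `G` acting (via
`act`) on the maximal chains of the rank-selected subposet `P_S`: its value at `g` is
the number of maximal chains of `P_S` fixed by `g`. -/
def gAlpha {P G : Type*} [Preorder P] [OrderBot P] [OrderTop P] (rk : P → ℕ)
    (act : G → P → P) (S : Finset ℕ) (g : G) : ℤ :=
  (Set.ncard {C : Set P | C ∈ maxChainsIn (rankSel rk S) ∧ act g '' C = C} : ℤ)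

/-- The character of the virtual representation
`β_P(S) = Σ_{T ⊆ S} (-1)^{|S-T|} α_P(T)`. -/
def gBeta {P G : Type*} [Preorder P] [OrderBot P] [OrderTop P] (rk : P → ℕ)
    (act : G → P → P) (S : Finset ℕ) (g : G) : ℤ :=
  ∑ T ∈ S.powerset, (-1 : ℤ) ^ (S.card - T.card) * gAlpha rk act T g

/-! ### The poset of injective words -/

/-- An injective word over the alphabet `{1,…,n}`. -/
def InjWord (n : ℕ) : Type := {l : List (Fin n) // l.Nodup}

instance (n : ℕ) : PartialOrder (InjWord n) where
  le u v := u.1.Sublist v.1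
  le_refl u := List.Sublist.refl _
  le_trans u v w h1 h2 := List.Sublist.trans h1 h2
  le_antisymm u v h1 h2 := Subtype.ext (List.Sublist.antisymm h1 h2)

instance (n : ℕ) : OrderBot (InjWord n) where
  bot := ⟨[], List.nodup_nil⟩
  bot_le u := List.nil_sublist u.1

/-- The rank function of the poset of injective words (with a maximum adjoined):
the rank of a word is its length, and the rank of `⊤` is `n+1`. -/
def rkInj (n : ℕ) (x : WithTop (InjWord n)) : ℕ :=
  WithTop.recTopCoe (n + 1) (fun u => u.1.length) x

/-- The action of `𝔖_n` on injective words, letter by letter. -/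
def permWord {n : ℕ} (w : Equiv.Perm (Fin n)) (u : InjWord n) : InjWord n :=
  ⟨u.1.map w, u.2.map w.injective⟩

/-- The character of `α_{P_n}(S)` for the `𝔖_n`-action on the poset of injective words. -/
def injAlpha (n : ℕ) (S : Finset ℕ) (g : Equiv.Perm (Fin n)) : ℤ :=
  gAlpha (rkInj n) (fun w : Equiv.Perm (Fin n) => WithTop.map (permWord w)) S g

/-- The character of `β_{P_n}(S)` for the `𝔖_n`-action on the poset of injective words. -/
def injBeta (n : ℕ) (S : Finset ℕ) (g : Equiv.Perm (Fin n)) : ℤ :=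
  gBeta (rkInj n) (fun w : Equiv.Perm (Fin n) => WithTop.map (permWord w)) S g

/-! ### The poset of r-colored injective words -/

/-- An `r`-colored injective word over `{1,…,n}`: a word in the alphabet
`{1,…,n} × ℤ_r` whose letters have pairwise distinct first coordinates. -/
def CInjWord (n r : ℕ) : Type := {l : List (Fin n × ZMod r) // (l.map Prod.fst).Nodup}

instance (n r : ℕ) : PartialOrder (CInjWord n r) where
  le u v := u.1.Sublist v.1
  le_refl u := List.Sublist.refl _
  le_trans u v w h1 h2 := List.Sublist.trans h1 h2
  le_antisymm u v h1 h2 := Subtype.ext (List.Sublist.antisymm h1 h2)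

instance (n r : ℕ) : OrderBot (CInjWord n r) where
  bot := ⟨[], by simp⟩
  bot_le u := List.nil_sublist u.1

/-- The rank function of the poset `P_{n,r}` of `r`-colored injective words
(with a maximum adjoined). -/
def rkC (n r : ℕ) (x : WithTop (CInjWord n r)) : ℕ :=
  WithTop.recTopCoe (n + 1) (fun u => u.1.length) x

/-- The action of `𝔖_n` on `r`-colored injective words: act on the first coordinate
of each letter, leaving colors unchanged. -/
def permCWord {n r : ℕ} (w : Equiv.Perm (Fin n)) (u : CInjWord n r) : CInjWord n r :=
  ⟨u.1.map (fun p => (w p.1, p.2)), by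
    have h := u.2.map w.injective
    rw [List.map_map] at h ⊢
    exact h⟩

/-- The character of `α_{P_{n,r}}(S)`. -/
def cAlpha (n r : ℕ) (S : Finset ℕ) (g : Equiv.Perm (Fin n)) : ℤ :=
  gAlpha (rkC n r) (fun w : Equiv.Perm (Fin n) => WithTop.map (permCWord w)) S g

/-- The character of `β_{P_{n,r}}(S)`. -/
def cBeta (n r : ℕ) (S : Finset ℕ) (g : Equiv.Perm (Fin n)) : ℤ :=
  gBeta (rkC n r) (fun w : Equiv.Perm (Fin n) => WithTop.map (permCWord w)) S g

/-- `b_{P_{n,r}}(S)`, the dimension of `β_{P_{n,r}}(S)`. -/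
def cChainDim (n r : ℕ) (S : Finset ℕ) : ℤ := bDim (rkC n r) S

/-! ### The statistics τ -/

/-- `τ(w,Q)` for a permutation `w` with descent set `S = {s_1 < ⋯ < s_k}` and a standard
Young tableau `Q`: the largest `i ∈ {0,…,k+1}` such that (a) `w(x) = w_S(x)` for
`x > s_{k+1-i}` and (b) no descent of `Q` is smaller than `n - s_{k+1-i}`. -/
def tau (n : ℕ) (S : Finset ℕ) (wS w : Equiv.Perm (Fin n)) {μ : YoungDiagram}
    (Q : SYT μ) : ℕ :=
  ((Finset.range (S.card + 2)).filter
    (fun i => (∀ x, sElt n S (S.card + 1 - i) < x → x ≤ n → permApp w x = permApp wS x) ∧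
      (∀ d ∈ Q.des, n - sElt n S (S.card + 1 - i) ≤ d))).max'
    ⟨0, by
      have hs := sElt_of_gt n S (S.card + 1 - 0) (by omega)
      refine Finset.mem_filter.2 ⟨Finset.mem_range.2 (by omega), ?_, ?_⟩
      · intro x hx hx'
        rw [hs] at hx
        exact absurd hx (not_lt.2 hx')
      · intro d _
        rw [hs]
        omega⟩

/-- The condition that all the numbers `1,…,t` appear in the first row of the `r`-colored
standard Young tableau `(Q, c)` and are colored with the zero color (the color of the
entry `k` being `c (k-1)`). -/
def zeroFirstRow {μ : YoungDiagram} {r : ℕ} (Q : SYT μ) (c : Fin μ.card → ZMod r)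
    (t : ℕ) : Prop :=
  ∀ k : Fin μ.card, (k : ℕ) < t →
    ((∃ j, (0, j) ∈ μ ∧ Q.entry 0 j = (k : ℕ) + 1) ∧ c k = 0)

/-- `τ(w,Q)` for an `r`-colored standard Young tableau `(Q,c)`. -/
def ctau (n : ℕ) {r : ℕ} (S : Finset ℕ) (wS w : Equiv.Perm (Fin n)) {μ : YoungDiagram}
    (Q : SYT μ) (c : Fin μ.card → ZMod r) : ℕ :=
  ((Finset.range (S.card + 2)).filter
    (fun i => (∀ x, sElt n S (S.card + 1 - i) < x → x ≤ n → permApp w x = permApp wS x) ∧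
      zeroFirstRow Q c (n - sElt n S (S.card + 1 - i)))).max'
    ⟨0, by
      have hs := sElt_of_gt n S (S.card + 1 - 0) (by omega)
      refine Finset.mem_filter.2 ⟨Finset.mem_range.2 (by omega), ?_, ?_⟩
      · intro x hx hx'
        rw [hs] at hx
        exact absurd hx (not_lt.2 hx')
      · rw [hs]
        intro k hk
        exact absurd hk (by omega)⟩

/-- The largest `i ∈ {0,…,n}` such that all the numbers `1,…,i` appear in the first row
of the `r`-colored standard Young tableau `(Q,c)` and are colored with the zero color. -/
def mQ (n : ℕ) {r : ℕ} {μ : YoungDiagram} (Q : SYT μ) (c : Fin μ.card → ZMod r) : ℕ :=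
  ((Finset.range (n + 1)).filter (fun i => zeroFirstRow Q c i)).max'
    ⟨0, Finset.mem_filter.2 ⟨Finset.mem_range.2 (by omega),
      fun k hk => absurd hk (by omega)⟩⟩

/-- The condition, for an `r`-colored permutation `(π, c)` (the color of the entry
`π(x)` in one-line notation being `c (x-1)`), that the entries `π(1),…,π(t)` are in
increasing order and all colored with the zero color. -/
def zeroIncreasing {n r : ℕ} (π : Equiv.Perm (Fin n)) (c : Fin n → ZMod r) (t : ℕ) : Prop :=
  (∀ x y, 1 ≤ x → x < y → y ≤ t → permApp π x < permApp π y) ∧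
  ∀ k : Fin n, (k : ℕ) < t → c k = 0

/-- `τ(w,u)` for an `r`-colored permutation `u = (π, c)`. -/
def tauU (n : ℕ) {r : ℕ} (S : Finset ℕ) (wS w : Equiv.Perm (Fin n))
    (π : Equiv.Perm (Fin n)) (c : Fin n → ZMod r) : ℕ :=
  ((Finset.range (S.card + 2)).filter
    (fun i => (∀ x, sElt n S (S.card + 1 - i) < x → x ≤ n → permApp w x = permApp wS x) ∧
      zeroIncreasing π c (n - sElt n S (S.card + 1 - i)))).max'
    ⟨0, by
      have hs := sElt_of_gt n S (S.card + 1 - 0) (by omega)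
      refine Finset.mem_filter.2 ⟨Finset.mem_range.2 (by omega), ?_, ?_, ?_⟩
      · intro x hx hx'
        rw [hs] at hx
        exact absurd hx (not_lt.2 hx')
      · intro x y hx hxy hy
        rw [hs] at hy
        exact absurd hy (by omega)
      · rw [hs]
        intro k hk
        exact absurd hk (by omega)⟩

/-- The largest `i ∈ {0,…,n}` such that the entries `π(1),…,π(i)` of the `r`-colored
permutation `(π,c)` are in increasing order and all colored with the zero color. -/
def mU (n : ℕ) {r : ℕ} (π : Equiv.Perm (Fin n)) (c : Fin n → ZMod r) : ℕ :=
  ((Finset.range (n + 1)).filter (fun i => zeroIncreasing π c i)).max'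
    ⟨0, Finset.mem_filter.2 ⟨Finset.mem_range.2 (by omega),
      fun x y hx hxy hy => absurd hy (by omega),
      fun k hk => absurd hk (by omega)⟩⟩

/-- `a_m(T)`: the number of chains in the Boolean lattice `B_m` whose elements have
set of ranks (cardinalities) equal to `T`. -/
def boolChains (m : ℕ) (T : Finset ℕ) : ℕ :=
  Nat.card {c : Finset (Finset (Fin m)) //
    IsChain (· ⊆ ·) (↑c : Set (Finset (Fin m))) ∧ c.image Finset.card = T}

end


lemma permApp_succ {m : ℕ} (w : Equiv.Perm (Fin m)) (i : ℕ) (h : i < m) :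
    permApp w (i + 1) = (w ⟨i, h⟩ : ℕ) + 1 := by
  simp [permApp, h]

lemma succ_mem_descentSet {m : ℕ} (w : Equiv.Perm (Fin m)) (i : ℕ) :
    i + 1 ∈ descentSet w ↔ ∃ h : i + 1 < m, w ⟨i + 1, h⟩ < w ⟨i, by omega⟩ := by
  unfold descentSet
  rw [Finset.mem_filter, Finset.mem_Icc]
  constructor
  · rintro ⟨h1, h2⟩
    have h : i + 1 < m := by omega
    refine ⟨h, ?_⟩
    rw [permApp_succ w (i + 1) h, permApp_succ w i (by omega)] at h2
    exact Fin.lt_def.2 (by omega)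
  · rintro ⟨h, h2⟩
    refine ⟨by omega, ?_⟩
    rw [permApp_succ w (i + 1) h, permApp_succ w i (by omega)]
    have := Fin.lt_def.1 h2
    omega

lemma zero_notMem_descentSet {m : ℕ} (w : Equiv.Perm (Fin m)) : 0 ∉ descentSet w := by
  simp [descentSet]

lemma lt_of_no_descent {m : ℕ} (w : Equiv.Perm (Fin m)) (T : Finset ℕ)
    (hT : descentSet w ⊆ T) (x : ℕ) (hx : x < m) : ∀ (y : ℕ) (hy : y < m), x < y →
    (∀ t ∈ T, t ≤ x ∨ y < t) → w ⟨x, hx⟩ < w ⟨y, hy⟩ := by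
  intro y
  induction y with
  | zero => intro _ h; omega
  | succ y ih =>
    intro hy hxy h
    have hstep : w ⟨y, by omega⟩ < w ⟨y + 1, hy⟩ := by
      by_contra hcon
      have hne : w ⟨y + 1, hy⟩ ≠ w ⟨y, by omega⟩ := by
        intro e
        have := w.injective e
        simp at this
      have hlt := lt_of_le_of_ne (not_lt.1 hcon) hne
      have := hT ((succ_mem_descentSet w y).2 ⟨hy, hlt⟩)
      have := h _ this
      omega
    rcases Nat.lt_or_ge x y with h1 | h1
    · refine lt_trans (ih (by omega) h1 ?_) hstep
      intro t ht
      have := h t ht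
      omega
    · have : x = y := by omega
      subst this
      exact hstep

lemma mem_iff_lt_of_lower {m t : ℕ} (B : Finset (Fin m))
    (h : ∀ x ∈ B, ∀ y, y ∉ B → x < y) (hc : B.card = t) (i : Fin m) : i ∈ B ↔ (i : ℕ) < t := by
  constructor
  · intro hi
    have : Finset.Iic i ⊆ B := by
      intro j hj
      by_contra hjB
      have := h i hi j hjB
      have := Finset.mem_Iic.1 hj
      omega
    have := Finset.card_le_card this
    simp at this
    omega
  · intro hi
    by_contra hiB
    have : B ⊆ Finset.Iio i := by
      intro j hj
      exact Finset.mem_Iio.2 (h j hj i hiB)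
    have := Finset.card_le_card this
    simp at this
    omega

/-- The flag of subsets of `Fin m` attached to a permutation. -/
noncomputable def flagOf {m : ℕ} (w : Equiv.Perm (Fin m)) (t : ℕ) : Finset (Fin m) :=
  Finset.univ.filter (fun i => (w.symm i : ℕ) < t)

lemma mem_flagOf {m : ℕ} (w : Equiv.Perm (Fin m)) (t : ℕ) (i : Fin m) :
    i ∈ flagOf w t ↔ (w.symm i : ℕ) < t := by
  simp [flagOf]

lemma card_flagOf {m : ℕ} (w : Equiv.Perm (Fin m)) (t : ℕ) (ht : t ≤ m) :
    (flagOf w t).card = t := by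
  have : flagOf w t = (Finset.univ.filter (fun i : Fin m => (i : ℕ) < t)).map
      w.toEmbedding := by
    ext i
    simp only [mem_flagOf, Finset.mem_map, Finset.mem_filter, Finset.mem_univ, true_and]
    constructor
    · intro h
      exact ⟨w.symm i, h, by simp⟩
    · rintro ⟨j, hj, rfl⟩
      simpa using hj
  rw [this, Finset.card_map, Fin.card_filter_val_lt]
  omega

/-- level of an element relative to a flag -/
noncomputable def levOf {m : ℕ} (T : Finset ℕ) (A : T → Finset (Fin m)) (x : Fin m) : ℕ :=
  (Finset.univ.filter (fun t : T => x ∉ A t)).card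

lemma eq_sort_levOf {m : ℕ} (T : Finset ℕ) (w : Equiv.Perm (Fin m)) (hw : descentSet w ⊆ T) :
    w = Tuple.sort (levOf T (fun t => flagOf w t)) := by
  rw [Tuple.eq_sort_iff]
  have key : ∀ i : Fin m, levOf T (fun t => flagOf w t) (w i) =
      (Finset.univ.filter (fun t : T => (t : ℕ) ≤ i)).card := by
    intro i
    unfold levOf
    congr 1
    ext t
    simp [mem_flagOf]
  constructor
  · intro i j hij
    simp only [Function.comp, key]
    apply Finset.card_le_card
    intro t
    simp only [Finset.mem_filter, Finset.mem_univ, true_and]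
    intro h
    exact h.trans hij
  · intro i j hij h
    rw [key, key] at h
    refine lt_of_no_descent w T hw i i.2 j j.2 hij ?_
    intro t ht
    by_contra hcon
    push Not at hcon
    have hss : (Finset.univ.filter (fun t : T => (t : ℕ) ≤ i)) ⊂
        (Finset.univ.filter (fun t : T => (t : ℕ) ≤ j)) := by
      rw [Finset.ssubset_iff_of_subset]
      · exact ⟨⟨t, ht⟩, by simpa using hcon.2, by simpa using hcon.1⟩
      · intro t
        simp only [Finset.mem_filter, Finset.mem_univ, true_and]
        intro h
        exact h.trans hij.le
    have := Finset.card_lt_card hss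
    omega

lemma sort_levOf {m : ℕ} (T : Finset ℕ) (A : T → Finset (Fin m)) (hA : Monotone A)
    (hc : ∀ t, (A t).card = t) :
    (∀ t : T, flagOf (Tuple.sort (levOf T A)) t = A t) ∧
      descentSet (Tuple.sort (levOf T A)) ⊆ T := by
  set w := Tuple.sort (levOf T A) with hw
  obtain ⟨h1, h2⟩ := Tuple.eq_sort_iff.1 hw
  have hlev : ∀ t x y, x ∈ A t → y ∉ A t → levOf T A x < levOf T A y := by
    intro t x y hx hy
    apply Finset.card_lt_card
    rw [Finset.ssubset_iff_of_subset]
    · exact ⟨t, by simpa using hy, by simpa using hx⟩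
    · intro t'
      simp only [Finset.mem_filter, Finset.mem_univ, true_and]
      intro hx' hy'
      rcases le_total t t' with h | h
      · exact hx' (hA h hx)
      · exact hy (hA h hy')
  have hmem : ∀ (t : T) (i : Fin m), w i ∈ A t ↔ (i : ℕ) < t := by
    intro t i
    have := mem_iff_lt_of_lower ((A t).map w.symm.toEmbedding) (t := t) ?_ ?_ i
    · rw [← this]
      simp only [Finset.mem_map_equiv, Equiv.symm_symm]
    · intro x hx y hy
      simp only [Finset.mem_map_equiv, Equiv.symm_symm] at hx hy
      by_contra hcon
      have := h1 (not_lt.1 hcon)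
      have := hlev t _ _ hx hy
      simp only [Function.comp] at *
      omega
    · rw [Finset.card_map, hc]
  refine ⟨?_, ?_⟩
  · intro t
    ext x
    rw [mem_flagOf, ← hmem t, Equiv.apply_symm_apply]
  · intro s hs
    rcases s with _ | i
    · exact absurd hs (zero_notMem_descentSet w)
    obtain ⟨hi, hlt⟩ := (succ_mem_descentSet w i).1 hs
    by_contra hsT
    have heq : levOf T A (w ⟨i, by omega⟩) = levOf T A (w ⟨i + 1, hi⟩) := by
      unfold levOf
      congr 1
      ext t
      simp only [Finset.mem_filter, Finset.mem_univ, true_and, hmem]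
      have : (t : ℕ) ≠ i + 1 := fun e => hsT (e ▸ t.2)
      omega
    have := h2 _ _ (Fin.lt_def.2 (Nat.lt_succ_self i)) heq
    exact absurd hlt (not_lt.2 this.le)

/-- Flags with ranks `T` are counted by the permutations with descent set inside `T`. -/
lemma card_flags (m : ℕ) (T : Finset ℕ) (hT : ∀ t ∈ T, t ≤ m) :
    Nat.card {A : T → Finset (Fin m) // Monotone A ∧ ∀ t, (A t).card = t} =
      Nat.card {w : Equiv.Perm (Fin m) // descentSet w ⊆ T} := by
  symm
  refine Nat.card_eq_of_bijective
    (fun w => ⟨fun t => flagOf w.1 t, ?_, fun t => card_flagOf _ _ (hT _ t.2)⟩) ⟨?_, ?_⟩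
  · intro s t hst i
    simp only [mem_flagOf]
    intro h
    exact lt_of_lt_of_le h hst
  · rintro ⟨w, hw⟩ ⟨w', hw'⟩ h
    have h' : (fun t : T => flagOf w t) = (fun t : T => flagOf w' t) := congrArg Subtype.val h
    apply Subtype.ext
    show w = w'
    rw [eq_sort_levOf T w hw, eq_sort_levOf T w' hw', h']
  · rintro ⟨A, hA, hc⟩
    obtain ⟨h1, h2⟩ := sort_levOf T A hA hc
    exact ⟨⟨_, h2⟩, Subtype.ext (funext h1)⟩


/-- the subword on a set of positions -/
noncomputable def posList {α : Type*} (l : List α) {m : ℕ} (h : l.length = m)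
    (A : Finset (Fin m)) : List α :=
  ((List.finRange m).filter (fun i => decide (i ∈ A))).map (fun i => l.get (i.cast h.symm))

lemma map_finRange_cast {α : Type*} (l : List α) {m : ℕ} (h : l.length = m) :
    (List.finRange m).map (fun i => l.get (i.cast h.symm)) = l := by
  subst h
  exact List.map_get_finRange l

lemma posList_univ {α : Type*} (l : List α) {m : ℕ} (h : l.length = m) :
    posList l h Finset.univ = l := by
  unfold posList
  rw [List.filter_eq_self.2 (by simp)]
  exact map_finRange_cast l h

lemma posList_mono {α : Type*} (l : List α) {m : ℕ} (h : l.length = m) {A B : Finset (Fin m)}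
    (hAB : A ⊆ B) : (posList l h A).Sublist (posList l h B) := by
  unfold posList
  apply List.Sublist.map
  apply List.monotone_filter_right
  intro i hi
  simp only [decide_eq_true_eq] at hi ⊢
  exact hAB hi

lemma length_posList {α : Type*} (l : List α) {m : ℕ} (h : l.length = m) (A : Finset (Fin m)) :
    (posList l h A).length = A.card := by
  unfold posList
  rw [List.length_map, ← List.toFinset_card_of_nodup ((List.nodup_finRange m).filter _)]
  congr 1
  ext i
  simp

lemma mem_posList {α : Type*} (l : List α) (hl : l.Nodup) {m : ℕ} (h : l.length = m)
    (A : Finset (Fin m)) (i : Fin m) : l.get (i.cast h.symm) ∈ posList l h A ↔ i ∈ A := by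
  unfold posList
  simp only [List.mem_map, List.mem_filter, List.mem_finRange, true_and, decide_eq_true_eq]
  constructor
  · rintro ⟨j, hj, e⟩
    have := (List.nodup_iff_injective_get.1 hl) e
    rw [Fin.cast_inj] at this
    rwa [← this]
  · intro hi
    exact ⟨i, hi, rfl⟩

lemma subset_of_posList_sublist {α : Type*} (l : List α) (hl : l.Nodup) {m : ℕ}
    (h : l.length = m) {A B : Finset (Fin m)}
    (hs : (posList l h A).Sublist (posList l h B)) : A ⊆ B := by
  intro i hi
  exact (mem_posList l hl h B i).1 (hs.subset ((mem_posList l hl h A i).2 hi))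

lemma exists_posList {α : Type*} (l : List α) {m : ℕ} (h : l.length = m) (l' : List α)
    (hs : l'.Sublist l) : ∃ A : Finset (Fin m), posList l h A = l' := by
  rw [← map_finRange_cast l h] at hs
  obtain ⟨k, hk, rfl⟩ := List.sublist_map_iff.1 hs
  refine ⟨k.toFinset, ?_⟩
  unfold posList
  congr 1
  have hp : ((List.finRange m).filter (fun i => decide (i ∈ k.toFinset))).Perm k := by
    rw [List.perm_ext_iff_of_nodup ((List.nodup_finRange m).filter _)
      (hk.nodup (List.nodup_finRange m))]
    intro a
    simp
  exact hp.eq_of_sortedLE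
    (((List.sortedLT_finRange m).pairwise.sublist List.filter_sublist).sortedLT.sortedLE)
    (((List.sortedLT_finRange m).pairwise.sublist hk).sortedLT.sortedLE)

lemma CInjWord.nodup {n r : ℕ} (x : CInjWord n r) : x.1.Nodup := List.Nodup.of_map _ x.2

/-- the subword on a set of positions, as a colored word -/
noncomputable def posWord {n r : ℕ} (x : CInjWord n r) {m : ℕ} (h : x.1.length = m)
    (A : Finset (Fin m)) : CInjWord n r :=
  ⟨posList x.1 h A, by
    have : (posList x.1 h A).Sublist x.1 := by
      have := posList_mono x.1 h (Finset.subset_univ A)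
      rwa [posList_univ] at this
    exact (this.map _).nodup x.2⟩

/-- graded multichains with ranks `T` in the poset of words -/
def GrChain (n r : ℕ) (T : Finset ℕ) : Type :=
  {F : T → CInjWord n r // Monotone F ∧ ∀ t, (F t).1.length = t}

lemma card_grChain (n r : ℕ) (T : Finset ℕ) (m : ℕ) (hm : m ∈ T) (hT : ∀ t ∈ T, t ≤ m) :
    Nat.card (GrChain n r T) = Nat.card {x : CInjWord n r // x.1.length = m} *
      Nat.card {w : Equiv.Perm (Fin m) // descentSet w ⊆ T} := by
  rw [← card_flags m T hT, ← Nat.card_prod]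
  let top : GrChain n r T → {x : CInjWord n r // x.1.length = m} :=
    fun F => ⟨F.1 ⟨m, hm⟩, F.2.2 _⟩
  have e : ∀ x : {x : CInjWord n r // x.1.length = m},
      {F : GrChain n r T // top F = x} ≃
        {A : T → Finset (Fin m) // Monotone A ∧ ∀ t, (A t).card = t} := by
    intro x
    let Φ : {A : T → Finset (Fin m) // Monotone A ∧ ∀ t, (A t).card = t} →
        {F : GrChain n r T // top F = x} := fun A =>
      ⟨⟨fun t => posWord x.1 x.2 (A.1 t),
        fun s t hst => posList_mono x.1.1 x.2 (A.2.1 hst),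
        fun t => (length_posList x.1.1 x.2 (A.1 t)).trans (A.2.2 t)⟩, by
        apply Subtype.ext
        apply Subtype.ext
        show posList x.1.1 x.2 (A.1 ⟨m, hm⟩) = x.1.1
        have : A.1 ⟨m, hm⟩ = Finset.univ := by
          rw [← Finset.card_eq_iff_eq_univ, A.2.2, Fintype.card_fin]
        rw [this, posList_univ]⟩
    refine (Equiv.ofBijective Φ ⟨?_, ?_⟩).symm
    · intro A B hAB
      apply Subtype.ext
      funext t
      have h1 : (posList x.1.1 x.2 (A.1 t)) = (posList x.1.1 x.2 (B.1 t)) :=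
        congrArg Subtype.val (congrFun (congrArg (fun F => F.1.1) hAB) t)
      apply Finset.Subset.antisymm
      · exact subset_of_posList_sublist x.1.1 x.1.nodup x.2 (by rw [h1])
      · exact subset_of_posList_sublist x.1.1 x.1.nodup x.2 (by rw [h1])
    · rintro ⟨⟨F, hF, hl⟩, htop⟩
      have htop' : F ⟨m, hm⟩ = x.1 := congrArg Subtype.val htop
      have hle : ∀ t, (F t).1.Sublist x.1.1 := by
        intro t
        rw [← htop']
        exact hF (a := t) (b := ⟨m, hm⟩) (hT _ t.2)
      choose A hA using fun t => exists_posList x.1.1 x.2 (F t).1 (hle t)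
      refine ⟨⟨A, ?_, ?_⟩, ?_⟩
      · intro s t hst
        apply subset_of_posList_sublist x.1.1 x.1.nodup x.2
        rw [hA, hA]
        exact hF hst
      · intro t
        rw [← length_posList x.1.1 x.2, hA, hl]
      · apply Subtype.ext
        apply Subtype.ext
        funext t
        exact Subtype.ext (hA t)
  exact Nat.card_congr ((Equiv.sigmaFiberEquiv top).symm.trans
    ((Equiv.sigmaCongrRight e).trans (Equiv.sigmaEquivProd _ _)))


lemma exists_sublist_between {α : Type*} {l₁ l₂ : List α} (h : l₁.Sublist l₂) :
    ∀ t, l₁.length ≤ t → t ≤ l₂.length →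
      ∃ l : List α, l₁.Sublist l ∧ l.Sublist l₂ ∧ l.length = t := by
  induction h with
  | slnil => intro t _ h; exact ⟨[], List.Sublist.refl _, List.Sublist.refl _, by simp at *; omega⟩
  | @cons l₁ l₂ a h ih =>
    intro t h1 h2
    rcases Nat.lt_or_ge l₂.length t with h3 | h3
    · refine ⟨a :: l₂, h.cons a, List.Sublist.refl _, ?_⟩
      simp at *
      omega
    · obtain ⟨l, ha, hb, hc⟩ := ih t h1 h3
      exact ⟨l, ha, hb.cons a, hc⟩
  | @cons_cons l₁ l₂ a h ih =>
    intro t h1 h2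
    simp only [List.length_cons] at h1 h2
    obtain ⟨l, ha, hb, hc⟩ := ih (t - 1) (by omega) (by omega)
    exact ⟨a :: l, ha.cons_cons a, hb.cons_cons a, by simp; omega⟩

lemma CInjWord.length_le {n r : ℕ} (x : CInjWord n r) : x.1.length ≤ n := by
  have := x.2.length_le_card
  simpa using this

lemma CInjWord.exists_full {n r : ℕ} (x : CInjWord n r) :
    ∃ y : CInjWord n r, x ≤ y ∧ y.1.length = n := by
  let k : List (Fin n) := (List.finRange n).filter (fun i => decide (i ∉ x.1.map Prod.fst))
  let l : List (Fin n × ZMod r) := x.1 ++ k.map (fun i => (i, 0))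
  have hm : l.map Prod.fst = x.1.map Prod.fst ++ k := by
    simp [l, List.map_map, Function.comp_def]
  have hnd : (l.map Prod.fst).Nodup := by
    rw [hm]
    refine List.Nodup.append x.2 ((List.nodup_finRange n).filter _) ?_
    intro a ha hb
    have := List.mem_filter.1 hb
    simp only [decide_eq_true_eq] at this
    exact this.2 ha
  refine ⟨⟨l, hnd⟩, List.sublist_append_left _ _, ?_⟩
  have h1 : (l.map Prod.fst).toFinset = Finset.univ := by
    ext i
    rw [hm]
    by_cases hi : i ∈ x.1.map Prod.fst
    · simp only [List.mem_toFinset, List.mem_append, hi, true_or, Finset.mem_univ]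
    · simp only [List.mem_toFinset, List.mem_append, hi, false_or, Finset.mem_univ, iff_true]
      exact List.mem_filter.2 ⟨List.mem_finRange i, by simpa using hi⟩
  have h2 := List.toFinset_card_of_nodup hnd
  rw [h1] at h2
  simp at h2
  exact h2.symm

section
variable {n r : ℕ}

lemma rkC_coe (x : CInjWord n r) : rkC n r (x : WithTop (CInjWord n r)) = x.1.length := rfl
lemma rkC_top : rkC n r ⊤ = n + 1 := rfl
lemma rkC_bot : rkC n r ⊥ = 0 := rfl

lemma rkC_mono {x y : WithTop (CInjWord n r)} (h : x ≤ y) : rkC n r x ≤ rkC n r y := by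
  induction y using WithTop.recTopCoe with
  | top =>
    induction x using WithTop.recTopCoe with
    | top => rfl
    | coe x =>
      have := x.length_le
      rw [rkC_coe, rkC_top]
      omega
  | coe y =>
    induction x using WithTop.recTopCoe with
    | top => simp at h
    | coe x => exact (WithTop.coe_le_coe.1 h : x.1.Sublist y.1).length_le

lemma eq_of_le_of_rkC {x y : WithTop (CInjWord n r)} (h : x ≤ y) (hr : rkC n r x = rkC n r y) :
    x = y := by
  induction y using WithTop.recTopCoe with
  | top =>
    induction x using WithTop.recTopCoe with
    | top => rfl
    | coe x =>
      have := x.length_le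
      rw [rkC_coe, rkC_top] at hr
      omega
  | coe y =>
    induction x using WithTop.recTopCoe with
    | top => simp at h
    | coe x =>
      congr 1
      exact Subtype.ext ((WithTop.coe_le_coe.1 h : x.1.Sublist y.1).eq_of_length hr)

lemma exists_between_rkC {x y : WithTop (CInjWord n r)} (h : x ≤ y) (t : ℕ)
    (h1 : rkC n r x ≤ t) (h2 : t ≤ rkC n r y) : ∃ z, x ≤ z ∧ z ≤ y ∧ rkC n r z = t := by
  have key : ∀ a b : CInjWord n r, a ≤ b → a.1.length ≤ t → t ≤ b.1.length →
      ∃ c : CInjWord n r, a ≤ c ∧ c ≤ b ∧ c.1.length = t := by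
    intro a b hab h1 h2
    obtain ⟨l, ha, hb, hc⟩ := exists_sublist_between (show a.1.Sublist b.1 from hab) t h1 h2
    exact ⟨⟨l, (hb.map _).nodup b.2⟩, ha, hb, hc⟩
  induction y using WithTop.recTopCoe with
  | top =>
    induction x using WithTop.recTopCoe with
    | top => exact ⟨⊤, le_rfl, le_rfl, le_antisymm h1 h2 ▸ rfl⟩
    | coe x =>
      rw [rkC_top] at h2
      rcases Nat.lt_or_ge n t with h3 | h3
      · exact ⟨⊤, le_top, le_rfl, by rw [rkC_top]; omega⟩
      · obtain ⟨y, hy, hyl⟩ := x.exists_full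
        obtain ⟨c, hc1, hc2, hc3⟩ := key x y hy h1 (by omega)
        exact ⟨c, WithTop.coe_le_coe.2 hc1, le_top, hc3⟩
  | coe y =>
    induction x using WithTop.recTopCoe with
    | top => simp at h
    | coe x =>
      obtain ⟨c, hc1, hc2, hc3⟩ := key x y (WithTop.coe_le_coe.1 h) h1 h2
      exact ⟨c, WithTop.coe_le_coe.2 hc1, WithTop.coe_le_coe.2 hc2, hc3⟩

lemma le_of_chain_rkC {C : Set (WithTop (CInjWord n r))} (hC : IsChain (· ≤ ·) C)
    {x y : WithTop (CInjWord n r)} (hx : x ∈ C) (hy : y ∈ C) (h : rkC n r x ≤ rkC n r y) :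
    x ≤ y := by
  rcases hC.total hx hy with h1 | h1
  · exact h1
  · rw [eq_of_le_of_rkC h1 (le_antisymm (rkC_mono h1) h)]

lemma exists_rank_of_maxChain {T : Finset ℕ} {C : Set (WithTop (CInjWord n r))}
    (hC : C ∈ maxChainsIn (rankSel (rkC n r) T)) (t : ℕ) (ht : t ∈ T) (htn : t ≤ n) :
    ∃ z ∈ C, rkC n r z = t := by
  obtain ⟨hsub, hch, hmax⟩ := hC
  have hins : ∀ z ∈ rankSel (rkC n r) T, (∀ c ∈ C, z ≤ c ∨ c ≤ z) → z ∈ C := by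
    intro z hz hcomp
    have := hmax (insert z C) (Set.insert_subset hz hsub)
      (hch.insert (fun b hb _ => hcomp b hb)) (Set.subset_insert _ _)
    rw [this]
    exact Set.mem_insert _ _
  have hbot : ⊥ ∈ C := hins ⊥ (Or.inr (by simp)) (fun c _ => Or.inl bot_le)
  have htop : ⊤ ∈ C := hins ⊤ (Or.inr (by simp)) (fun c _ => Or.inr le_top)
  -- greatest element of rank at most t
  have hfin1 : (rkC n r '' {c ∈ C | rkC n r c ≤ t}).Finite :=
    (Set.finite_Iic t).subset (by rintro _ ⟨c, hc, rfl⟩; exact hc.2)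
  have hfin2 : (rkC n r '' {c ∈ C | t ≤ rkC n r c}).Finite :=
    (Set.finite_Iic (n + 1)).subset (by
      rintro _ ⟨c, hc, rfl⟩
      exact rkC_top (n := n) (r := r) ▸ rkC_mono le_top)
  obtain ⟨_, ⟨x, ⟨hxC, hxt⟩, rfl⟩, hx⟩ := Set.exists_max_image _ id hfin1
    ⟨_, ⊥, ⟨hbot, by rw [rkC_bot]; omega⟩, rfl⟩
  obtain ⟨_, ⟨y, ⟨hyC, hyt⟩, rfl⟩, hy⟩ := Set.exists_min_image _ id hfin2
    ⟨_, ⊤, ⟨htop, by rw [rkC_top]; omega⟩, rfl⟩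
  obtain ⟨z, hxz, hzy, hzt⟩ := exists_between_rkC (le_of_chain_rkC hch hxC hyC (hxt.trans hyt))
    t hxt hyt
  refine ⟨z, hins z (Or.inl (by simpa [hzt] using ht)) ?_, hzt⟩
  intro c hc
  rcases le_total (rkC n r c) t with h | h
  · exact Or.inr ((le_of_chain_rkC hch hc hxC (hx _ ⟨c, ⟨hc, h⟩, rfl⟩)).trans hxz)
  · exact Or.inl (hzy.trans (le_of_chain_rkC hch hyC hc (hy _ ⟨c, ⟨hc, h⟩, rfl⟩)))

/-- the maximal chain attached to a graded multichain -/
def chainOf {T : Finset ℕ} (F : GrChain n r T) : Set (WithTop (CInjWord n r)) :=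
  Set.range (fun t => (F.1 t : WithTop (CInjWord n r))) ∪ {⊥, ⊤}

lemma chainOf_mem {T : Finset ℕ} (F : GrChain n r T) :
    chainOf F ∈ maxChainsIn (rankSel (rkC n r) T) := by
  refine ⟨?_, ?_, ?_⟩
  · rintro _ (⟨t, rfl⟩ | h)
    · left
      show rkC n r _ ∈ T
      simp only [rkC_coe, F.2.2]
      exact t.2
    · exact Or.inr h
  · rintro x hx y hy _
    rcases hx with ⟨s, rfl⟩ | rfl | rfl
    · rcases hy with ⟨t, rfl⟩ | rfl | rfl
      · rcases le_total s t with h | h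
        · exact Or.inl (WithTop.coe_le_coe.2 (F.2.1 h))
        · exact Or.inr (WithTop.coe_le_coe.2 (F.2.1 h))
      · exact Or.inr bot_le
      · exact Or.inl le_top
    · exact Or.inl bot_le
    · exact Or.inr le_top
  · intro D hD hDc hFD
    apply Set.Subset.antisymm hFD
    intro d hd
    rcases hD hd with h | h
    · have hF : ((F.1 ⟨_, h⟩ : CInjWord n r) : WithTop (CInjWord n r)) ∈ chainOf F :=
        Or.inl ⟨⟨_, h⟩, rfl⟩
      have hrk : rkC n r ((F.1 ⟨_, h⟩ : CInjWord n r) : WithTop (CInjWord n r)) = rkC n r d := by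
        rw [rkC_coe, F.2.2]
      have := le_of_chain_rkC hDc (hFD hF) hd hrk.le
      rw [← eq_of_le_of_rkC this hrk]
      exact hF
    · exact Or.inr h

lemma chainCount_eq (T : Finset ℕ) (hT : ∀ t ∈ T, t ≤ n) :
    chainCount (rkC n r) T = Nat.card (GrChain n r T) := by
  unfold chainCount
  rw [← Nat.card_coe_set_eq]
  symm
  refine Nat.card_eq_of_bijective (fun F => ⟨chainOf F, chainOf_mem F⟩) ⟨?_, ?_⟩
  · intro F G h
    have h' : chainOf F = chainOf G := congrArg Subtype.val h
    apply Subtype.ext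
    funext t
    have hF : ((F.1 t : CInjWord n r) : WithTop (CInjWord n r)) ∈ chainOf G :=
      h' ▸ Or.inl ⟨t, rfl⟩
    have hG : ((G.1 t : CInjWord n r) : WithTop (CInjWord n r)) ∈ chainOf G := Or.inl ⟨t, rfl⟩
    have hrk : rkC n r ((F.1 t : CInjWord n r) : WithTop (CInjWord n r)) =
        rkC n r ((G.1 t : CInjWord n r) : WithTop (CInjWord n r)) := by
      rw [rkC_coe, rkC_coe, F.2.2, G.2.2]
    exact WithTop.coe_injective
      (eq_of_le_of_rkC (le_of_chain_rkC (chainOf_mem G).2.1 hF hG hrk.le) hrk)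
  · rintro ⟨C, hC⟩
    have hex : ∀ t : T, ∃ z : CInjWord n r, (z : WithTop (CInjWord n r)) ∈ C ∧
        z.1.length = t := by
      intro t
      obtain ⟨z, hz, hzt⟩ := exists_rank_of_maxChain hC t t.2 (hT _ t.2)
      induction z using WithTop.recTopCoe with
      | top =>
        have := hT _ t.2
        rw [rkC_top] at hzt
        omega
      | coe z => exact ⟨z, hz, hzt⟩
    choose F hF hl using hex
    have hmono : Monotone F := by
      intro s t hst
      apply WithTop.coe_le_coe.1
      apply le_of_chain_rkC hC.2.1 (hF s) (hF t)
      rw [rkC_coe, rkC_coe, hl, hl]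
      exact hst
    let G : GrChain n r T := ⟨F, hmono, hl⟩
    refine ⟨G, Subtype.ext ?_⟩
    show chainOf G = C
    symm
    apply Set.Subset.antisymm
    · intro c hc
      rcases hC.1 hc with h | h
      · have hrk : rkC n r (F ⟨_, h⟩ : WithTop (CInjWord n r)) = rkC n r c := by
          rw [rkC_coe, hl]
        rw [← eq_of_le_of_rkC (le_of_chain_rkC hC.2.1 (hF ⟨_, h⟩) hc hrk.le) hrk]
        exact Or.inl ⟨_, rfl⟩
      · exact Or.inr h
    · have hins : ∀ z ∈ rankSel (rkC n r) T, (∀ c ∈ C, z ≤ c ∨ c ≤ z) → z ∈ C := by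
        intro z hz hcomp
        have := hC.2.2 (insert z C) (Set.insert_subset hz hC.1)
          (hC.2.1.insert (fun b hb _ => hcomp b hb)) (Set.subset_insert _ _)
        rw [this]
        exact Set.mem_insert _ _
      rintro _ (⟨t, rfl⟩ | rfl | rfl)
      · exact hF t
      · exact hins ⊥ (Or.inr (by simp)) (fun c _ => Or.inl bot_le)
      · exact hins ⊤ (Or.inr (by simp)) (fun c _ => Or.inr le_top)

end


lemma neg_one_pow_sub_card {S T : Finset ℕ} (h : T ⊆ S) :
    (-1 : ℤ) ^ (S.card - T.card) = (-1) ^ S.card * (-1) ^ T.card := by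
  have := Finset.card_le_card h
  obtain ⟨k, hk⟩ := Nat.exists_eq_add_of_le this
  rw [hk, Nat.add_sub_cancel_left, pow_add, mul_comm, ← mul_assoc, ← pow_add]
  rw [Even.neg_one_pow ⟨_, rfl⟩, one_mul]

lemma mobius_indicator (S : Finset ℕ) : ∀ D : Finset ℕ,
    ∑ T ∈ S.powerset, (-1 : ℤ) ^ S.card * (-1) ^ T.card * (if D ⊆ T then 1 else 0) =
      if D = S then 1 else 0 := by
  induction S using Finset.induction_on with
  | empty => intro D; simp [Finset.subset_empty]
  | insert a S ha ih =>
    intro D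
    rw [Finset.sum_powerset_insert ha, Finset.card_insert_of_notMem ha]
    by_cases haD : a ∈ D
    · have h1 : ∀ T ∈ S.powerset,
          (-1 : ℤ) ^ (S.card + 1) * (-1) ^ T.card * (if D ⊆ T then 1 else 0) = 0 := by
        intro T hT
        rw [if_neg, mul_zero]
        intro h
        exact ha (Finset.mem_powerset.1 hT (h haD))
      have h2 : ∀ T ∈ S.powerset,
          (-1 : ℤ) ^ (S.card + 1) * (-1) ^ (insert a T).card *
            (if D ⊆ insert a T then 1 else 0) =
          (-1 : ℤ) ^ S.card * (-1) ^ T.card * (if D.erase a ⊆ T then 1 else 0) := by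
        intro T hT
        have : a ∉ T := fun h => ha (Finset.mem_powerset.1 hT h)
        simp only [Finset.card_insert_of_notMem this, Finset.subset_insert_iff]
        ring
      rw [Finset.sum_eq_zero h1, Finset.sum_congr rfl h2, ih, zero_add]
      congr 1
      apply propext
      constructor
      · intro h
        rw [← h, Finset.insert_erase haD]
      · intro h
        rw [h, Finset.erase_insert ha]
    · rw [← Finset.sum_add_distrib, if_neg]
      · apply Finset.sum_eq_zero
        intro T hT
        have : a ∉ T := fun h => ha (Finset.mem_powerset.1 hT h)
        simp only [Finset.card_insert_of_notMem this, Finset.subset_insert_iff_of_notMem haD]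
        ring
      · intro h
        exact haD (h ▸ Finset.mem_insert_self a S)

lemma descentSet_subset_insert {m : ℕ} (w : Equiv.Perm (Fin m)) (T : Finset ℕ) :
    descentSet w ⊆ insert m T ↔ descentSet w ⊆ T := by
  apply Finset.subset_insert_iff_of_notMem
  simp only [descentSet, Finset.mem_filter, Finset.mem_Icc]
  omega

lemma mobius_numDescentSet (m : ℕ) (S : Finset ℕ) :
    ∑ T ∈ S.powerset, (-1 : ℤ) ^ S.card * (-1) ^ T.card *
      (Nat.card {w : Equiv.Perm (Fin m) // descentSet w ⊆ insert m T} : ℤ) =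
      numDescentSet m S := by
  have hc : ∀ p : Equiv.Perm (Fin m) → Prop,
      (Nat.card {w : Equiv.Perm (Fin m) // p w} : ℤ) = ∑ w, if p w then 1 else 0 := by
    intro p
    rw [Nat.card_eq_fintype_card, Fintype.card_subtype]
    simp
  unfold numDescentSet
  simp only [hc, descentSet_subset_insert, Finset.mul_sum]
  rw [Finset.sum_comm]
  apply Finset.sum_congr rfl
  intro w _
  convert mobius_indicator S (descentSet w)

/-- number of words of a given length -/
noncomputable def numWords (n r m : ℕ) : ℕ := Nat.card {x : CInjWord n r // x.1.length = m}

lemma numWords_zero (n r : ℕ) : numWords n r 0 = 1 := by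
  unfold numWords
  rw [Nat.card_eq_one_iff_unique]
  refine ⟨⟨?_⟩, ⟨⟨⊥, rfl⟩⟩⟩
  rintro ⟨⟨a, ha⟩, ha'⟩ ⟨⟨b, hb⟩, hb'⟩
  have h1 := List.length_eq_zero_iff.1 ha'
  have h2 := List.length_eq_zero_iff.1 hb'
  apply Subtype.ext
  apply Subtype.ext
  exact h1.trans h2.symm

lemma numDescentSet_zero : numDescentSet 0 ∅ = 1 := by
  unfold numDescentSet
  rw [Nat.card_eq_one_iff_unique]
  exact ⟨⟨fun a b => Subtype.ext (Subsingleton.elim _ _)⟩, ⟨⟨1, by simp [descentSet]⟩⟩⟩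

lemma bDim_empty (n r : ℕ) : bDim (rkC n r) ∅ = 1 := by
  unfold bDim
  simp only [Finset.powerset_empty, Finset.sum_singleton]
  rw [chainCount_eq _ (by simp)]
  have : Nat.card (GrChain n r ∅) = 1 := by
    rw [Nat.card_eq_one_iff_unique]
    refine ⟨⟨fun F G => Subtype.ext (funext fun t => absurd t.2 (Finset.notMem_empty _))⟩,
      ⟨⟨fun t => absurd t.2 (Finset.notMem_empty _), fun t => absurd t.2 (Finset.notMem_empty _),
        fun t => absurd t.2 (Finset.notMem_empty _)⟩⟩⟩
  simp [this]

lemma bDim_insert (n r m : ℕ) (S : Finset ℕ) (hm : m ≤ n) (hS : ∀ s ∈ S, s < m) :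
    bDim (rkC n r) (insert m S) =
      - bDim (rkC n r) S + numWords n r m * numDescentSet m S := by
  have hmS : m ∉ S := fun h => lt_irrefl _ (hS m h)
  unfold bDim
  rw [Finset.sum_powerset_insert hmS]
  congr 1
  · rw [← Finset.sum_neg_distrib]
    apply Finset.sum_congr rfl
    intro T hT
    have hT := Finset.mem_powerset.1 hT
    rw [neg_one_pow_sub_card hT, neg_one_pow_sub_card (hT.trans (Finset.subset_insert _ _)),
      Finset.card_insert_of_notMem hmS]
    ring
  · rw [← mobius_numDescentSet, Finset.mul_sum]
    apply Finset.sum_congr rfl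
    intro T hT
    have hT := Finset.mem_powerset.1 hT
    have hmT : m ∉ T := fun h => hmS (hT h)
    have hle : ∀ t ∈ insert m T, t ≤ m := by
      intro t ht
      rcases Finset.mem_insert.1 ht with h | h
      · exact h.le
      · exact (hS t (hT h)).le
    rw [chainCount_eq _ (fun t ht => (hle t ht).trans hm),
      card_grChain n r (insert m T) m (Finset.mem_insert_self _ _) hle,
      Finset.card_insert_of_notMem hmS, Finset.card_insert_of_notMem hmT,
      Nat.add_sub_add_right, neg_one_pow_sub_card hT, numWords]
    push_cast
    ring

lemma bDim_formula (n r : ℕ) (S : Finset ℕ) : (∀ s ∈ S, 0 < s ∧ s ≤ n) →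
    bDim (rkC n r) S = ∑ s ∈ insert 0 S, (-1 : ℤ) ^ (S.filter (fun x => s < x)).card *
      (numDescentSet s (S.filter (fun x => x < s)) * numWords n r s) := by
  induction S using Finset.induction_on_max with
  | empty =>
    intro _
    simp [bDim_empty, numWords_zero, numDescentSet_zero]
  | insert m S hS ih =>
    intro hb
    have hmS : m ∉ insert 0 S := by
      intro h
      rcases Finset.mem_insert.1 h with h | h
      · have := (hb m (Finset.mem_insert_self _ _)).1
        omega
      · exact lt_irrefl _ (hS m h)
    rw [bDim_insert n r m S (hb m (Finset.mem_insert_self _ _)).2 hS,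
      ih (fun s hs => hb s (Finset.mem_insert_of_mem hs)), Finset.insert_comm,
      Finset.sum_insert hmS, add_comm]
    congr 1
    · rw [Finset.filter_eq_empty_iff.2, Finset.filter_insert, if_neg (lt_irrefl m),
        Finset.filter_true_of_mem hS]
      · simp; ring
      · intro x hx
        rcases Finset.mem_insert.1 hx with h | h
        · omega
        · have := hS x h
          omega
    · rw [← Finset.sum_neg_distrib]
      apply Finset.sum_congr rfl
      intro s hs
      have hsm : s < m := by
        rcases Finset.mem_insert.1 hs with h | h
        · rw [h]; exact (hb m (Finset.mem_insert_self _ _)).1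
        · exact hS s h
      rw [Finset.filter_insert, if_pos hsm, Finset.filter_insert, if_neg (by omega),
        Finset.card_insert_of_notMem]
      · ring
      · intro h
        exact lt_irrefl _ (hS m (Finset.mem_filter.1 h).1)


/-- permutations increasing on the first `k` positions -/
lemma card_increasing_perm (k s : ℕ) :
    Nat.card {π : Equiv.Perm (Fin (k + s)) //
      StrictMono (fun i : Fin k => π (Fin.castAdd s i))} = Nat.card (Fin s ↪ Fin (k + s)) := by
  refine Nat.card_eq_of_bijective (fun π => ⟨fun i => π.1 (Fin.natAdd k i), ?_⟩) ⟨?_, ?_⟩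
  · intro i j h
    exact Fin.natAdd_injective _ _ (π.1.injective h)
  · rintro ⟨π, hπ⟩ ⟨ρ, hρ⟩ h
    have h1 : ∀ i, π (Fin.natAdd k i) = ρ (Fin.natAdd k i) := fun i =>
      congrFun (congrArg (fun f : Fin s ↪ Fin (k + s) => (f : Fin s → Fin (k + s))) h) i
    have hrange : ∀ τ : Equiv.Perm (Fin (k + s)),
        Set.range (fun i : Fin k => τ (Fin.castAdd s i)) =
          (Set.range (fun i : Fin s => τ (Fin.natAdd k i)))ᶜ := by
      intro τ
      ext y
      simp only [Set.mem_range, Set.mem_compl_iff, not_exists]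
      obtain ⟨x, rfl⟩ := τ.surjective y
      refine Fin.addCases (fun i => ?_) (fun i => ?_) x
      · constructor
        · intro _ j hj
          have := τ.injective hj
          rw [Fin.ext_iff] at this
          simp at this
          omega
        · intro _
          exact ⟨i, rfl⟩
      · constructor
        · rintro ⟨j, hj⟩
          have := τ.injective hj
          rw [Fin.ext_iff] at this
          simp at this
          omega
        · intro h
          exact absurd rfl (h i)
    have h2 : (fun i : Fin k => π (Fin.castAdd s i)) = fun i : Fin k => ρ (Fin.castAdd s i) := by
      apply (hπ.range_inj hρ).1
      rw [hrange, hrange]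
      simp only [h1]
    apply Subtype.ext
    apply Equiv.ext
    intro x
    exact Fin.addCases (fun i => congrFun h2 i) (fun i => h1 i) x
  · intro f
    have hcard : ((Finset.univ.map f)ᶜ : Finset (Fin (k + s))).card = k := by
      rw [Finset.card_compl, Finset.card_map]
      simp
    let e := Finset.orderEmbOfFin _ hcard
    let g : Fin (k + s) → Fin (k + s) := fun x => Fin.addCases (fun i => e i) (fun i => f i) x
    have hg1 : ∀ i, g (Fin.castAdd s i) = e i := fun i => by simp [g]
    have hg2 : ∀ i, g (Fin.natAdd k i) = f i := fun i => by simp [g]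
    have hne : ∀ i j, e i ≠ f j := by
      intro i j h
      have := Finset.orderEmbOfFin_mem _ hcard i
      rw [Finset.mem_compl] at this
      apply this
      rw [Finset.mem_map]
      exact ⟨j, Finset.mem_univ _, h.symm⟩
    have hinj : Function.Injective g := by
      intro x y
      refine Fin.addCases (fun i => ?_) (fun i => ?_) x <;>
        refine Fin.addCases (fun j => ?_) (fun j => ?_) y <;>
        simp only [hg1, hg2] <;> intro h
      · rw [e.injective h]
      · exact absurd h (hne _ _)
      · exact absurd h.symm (hne _ _)
      · rw [f.injective h]
    refine ⟨⟨Equiv.ofBijective g (Finite.injective_iff_bijective.1 hinj), ?_⟩, ?_⟩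
    · intro i j hij
      simp only [Equiv.ofBijective_apply, hg1]
      exact e.strictMono hij
    · ext i
      simp only [Function.Embedding.coeFn_mk, Equiv.ofBijective_apply, hg2]

lemma card_zero_colorings (k s r : ℕ) :
    Nat.card {c : Fin (k + s) → ZMod r // ∀ x : Fin (k + s), (x : ℕ) < k → c x = 0} =
      Nat.card (Fin s → ZMod r) := by
  refine Nat.card_eq_of_bijective (fun c i => c.1 (Fin.natAdd k i)) ⟨?_, ?_⟩
  · rintro ⟨c, hc⟩ ⟨d, hd⟩ h
    apply Subtype.ext
    funext x
    refine Fin.addCases (fun i => ?_) (fun i => congrFun h i) x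
    show c _ = d _
    rw [hc _ (by simp), hd _ (by simp)]
  · intro g
    refine ⟨⟨fun x => Fin.addCases (fun _ => 0) (fun i => g i) x, ?_⟩, ?_⟩
    · intro x
      refine Fin.addCases (fun i => ?_) (fun i => ?_) x
      · intro _; simp
      · intro h; simp at h
    · funext i
      simp

lemma numWords_eq (n r s : ℕ) :
    numWords n r s = Nat.card (Fin s ↪ Fin n) * Nat.card (Fin s → ZMod r) := by
  rw [← Nat.card_prod]
  symm
  refine Nat.card_eq_of_bijective
    (fun p => ⟨⟨List.ofFn (fun i => (p.1 i, p.2 i)), ?_⟩, by simp⟩) ⟨?_, ?_⟩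
  · rw [List.map_ofFn, List.nodup_ofFn]
    exact p.1.injective
  · rintro ⟨f, g⟩ ⟨f', g'⟩ h
    have h' := List.ofFn_injective (congrArg (fun x => x.1.1) h)
    have h1 : f = f' := by
      ext i
      have := congrArg Prod.fst (congrFun h' i)
      simp only at this
      rw [this]
    have h2 : g = g' := by
      funext i
      exact congrArg Prod.snd (congrFun h' i)
    rw [h1, h2]
  · rintro ⟨⟨l, hl⟩, hs⟩
    have hs : l.length = s := hs
    subst hs
    refine ⟨⟨⟨fun i => (l.get i).1, ?_⟩, fun i => (l.get i).2⟩, ?_⟩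
    · intro i j h
      have := List.nodup_iff_injective_get.1 hl
      have h2 := @this (i.cast (by simp)) (j.cast (by simp)) (by simpa using h)
      simpa [Fin.ext_iff] using h2
    · apply Subtype.ext
      apply Subtype.ext
      show List.ofFn (fun i => l.get i) = l
      exact List.ofFn_get l

lemma zeroIncreasing_iff (k s r : ℕ) (π : Equiv.Perm (Fin (k + s))) (c : Fin (k + s) → ZMod r) :
    zeroIncreasing π c k ↔ StrictMono (fun i : Fin k => π (Fin.castAdd s i)) ∧
      ∀ x : Fin (k + s), (x : ℕ) < k → c x = 0 := by
  unfold zeroIncreasing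
  apply and_congr_left'
  constructor
  · intro h i j hij
    have hij' := Fin.lt_def.1 hij
    have := h (i + 1) (j + 1) (by omega) (by omega) (by omega)
    rw [permApp_succ π i (by omega), permApp_succ π j (by omega)] at this
    exact Fin.lt_def.2 (Nat.lt_of_add_lt_add_right this)
  · intro h x y hx hxy hy
    obtain ⟨i, rfl⟩ := Nat.exists_eq_add_of_le' hx
    obtain ⟨j, rfl⟩ := Nat.exists_eq_add_of_le' (hx.trans hxy.le)
    rw [permApp_succ π i (by omega), permApp_succ π j (by omega)]
    have := @h ⟨i, by omega⟩ ⟨j, by omega⟩ (Fin.lt_def.2 (by simpa using hxy))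
    exact Nat.add_lt_add_right (Fin.lt_def.1 this) 1

lemma card_zeroIncreasing (n r s : ℕ) (hs : s ≤ n) :
    Nat.card {u : Equiv.Perm (Fin n) × (Fin n → ZMod r) // zeroIncreasing u.1 u.2 (n - s)} =
      numWords n r s := by
  obtain ⟨k, rfl⟩ := Nat.exists_eq_add_of_le' hs
  rw [Nat.add_sub_cancel, numWords_eq, ← card_increasing_perm, ← card_zero_colorings k s r,
    ← Nat.card_prod]
  apply Nat.card_congr
  exact (Equiv.subtypeEquivRight (fun (u : Equiv.Perm (Fin (k + s)) × (Fin (k + s) → ZMod r)) =>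
      zeroIncreasing_iff k s r u.1 u.2)).trans
    (Equiv.subtypeProdEquivProd (p := fun π : Equiv.Perm (Fin (k + s)) =>
      StrictMono (fun i : Fin k => π (Fin.castAdd s i)))
      (q := fun c : Fin (k + s) → ZMod r => ∀ x : Fin (k + s), (x : ℕ) < k → c x = 0))


lemma exists_block_perm (n : ℕ) (S : Finset ℕ) (hS : S ⊆ Finset.Icc 1 (n - 1)) :
    ∃ v : Equiv.Perm (Fin n), descentSet v = S ∧
      ∀ p q : Fin n, ∀ s ∈ S, (p : ℕ) < s → s ≤ q → v q < v p := by
  let lev : Fin n → ℕ := fun x => (S.filter (fun s => s ≤ (x : ℕ))).card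
  let f : Fin n → ℕᵒᵈ := fun x => OrderDual.toDual (lev x)
  let σ := Tuple.sort f
  obtain ⟨h1, h2⟩ := Tuple.eq_sort_iff.1 (rfl : σ = Tuple.sort f)
  have hlt : ∀ p q : Fin n, lev p < lev q → σ.symm q < σ.symm p := by
    intro p q h
    by_contra hcon
    have := h1 (not_lt.1 hcon)
    simp only [Function.comp, Equiv.apply_symm_apply, f] at this
    have := OrderDual.toDual_le_toDual.1 this
    omega
  have heq : ∀ p q : Fin n, p < q → lev p = lev q → σ.symm p < σ.symm q := by
    intro p q hpq h
    by_contra hcon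
    have hne : σ.symm q ≠ σ.symm p := fun e => hpq.ne' (σ.symm.injective e)
    have := h2 _ _ (lt_of_le_of_ne (not_lt.1 hcon) hne) (by simp [f, h])
    simp only [Equiv.apply_symm_apply] at this
    exact absurd hpq (not_lt.2 this.le)
  have hcross : ∀ p q : Fin n, ∀ s ∈ S, (p : ℕ) < s → s ≤ q → σ.symm q < σ.symm p := by
    intro p q s hs hp hq
    apply hlt
    apply Finset.card_lt_card
    rw [Finset.ssubset_iff_of_subset]
    · exact ⟨s, by simp [hs, hq], by simp [hp]⟩
    · intro t
      simp only [Finset.mem_filter]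
      intro h
      exact ⟨h.1, by omega⟩
  refine ⟨σ.symm, ?_, hcross⟩
  ext t
  rcases t with _ | i
  · constructor
    · intro h
      exact absurd h (zero_notMem_descentSet _)
    · intro h
      have := Finset.mem_Icc.1 (hS h)
      omega
  · rw [succ_mem_descentSet]
    constructor
    · rintro ⟨h, hd⟩
      by_contra hi
      have : lev ⟨i, by omega⟩ = lev ⟨i + 1, h⟩ := by
        simp only [lev]
        congr 1
        ext t
        simp only [Finset.mem_filter]
        constructor
        · rintro ⟨a, b⟩
          exact ⟨a, by omega⟩
        · rintro ⟨a, b⟩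
          have : t ≠ i + 1 := fun e => hi (e ▸ a)
          exact ⟨a, by omega⟩
      have := heq _ _ (Fin.lt_def.2 (Nat.lt_succ_self i)) this
      exact absurd hd (not_lt.2 this.le)
    · intro hi
      have := Finset.mem_Icc.1 (hS hi)
      exact ⟨by omega, hcross _ _ (i + 1) hi (by simp) (by simp)⟩

lemma longest_cross (n : ℕ) (S : Finset ℕ) (hS : S ⊆ Finset.Icc 1 (n - 1))
    (wS : Equiv.Perm (Fin n)) (hwS : descentSet wS = S)
    (hwSmax : ∀ v : Equiv.Perm (Fin n), descentSet v = S → invCount v ≤ invCount wS)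
    (p q : Fin n) (s : ℕ) (hs : s ∈ S) (hp : (p : ℕ) < s) (hq : s ≤ q) : wS q < wS p := by
  obtain ⟨v, hv, hvc⟩ := exists_block_perm n S hS
  let X : Finset (Fin n × Fin n) :=
    Finset.univ.filter (fun p => ∃ s ∈ S, (p.1 : ℕ) < s ∧ s ≤ p.2)
  have h1 : X ⊆ Finset.univ.filter fun p : Fin n × Fin n => p.1 < p.2 ∧ v p.2 < v p.1 := by
    rintro ⟨a, b⟩ h
    obtain ⟨t, ht, ha, hb⟩ := (Finset.mem_filter.1 h).2
    refine Finset.mem_filter.2 ⟨Finset.mem_univ _, Fin.lt_def.2 (by simp at *; omega), ?_⟩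
    exact hvc a b t ht ha hb
  have h2 : (Finset.univ.filter fun p : Fin n × Fin n => p.1 < p.2 ∧ wS p.2 < wS p.1) ⊆ X := by
    rintro ⟨a, b⟩ h
    obtain ⟨hab, hw⟩ := (Finset.mem_filter.1 h).2
    refine Finset.mem_filter.2 ⟨Finset.mem_univ _, ?_⟩
    by_contra hcon
    push Not at hcon
    have := lt_of_no_descent wS S hwS.le a a.2 b b.2 hab (fun t ht => by
      have := hcon t ht
      simp only at this
      by_cases h : t ≤ a
      · exact Or.inl h
      · exact Or.inr (this (by omega)))
    exact absurd hw (not_lt.2 this.le)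
  have h3 := Finset.eq_of_subset_of_card_le h2
    ((Finset.card_le_card h1).trans (hwSmax v hv))
  have : (p, q) ∈ X := Finset.mem_filter.2 ⟨Finset.mem_univ _, s, hs, hp, hq⟩
  rw [← h3] at this
  exact (Finset.mem_filter.1 this).2.2

lemma low_iff {n s : ℕ} (hsn : s ≤ n) (w : Equiv.Perm (Fin n))
    (h : ∀ p q : Fin n, (p : ℕ) < s → s ≤ q → w q < w p) (y : Fin n) :
    (w y : ℕ) < n - s ↔ s ≤ y := by
  have := mem_iff_lt_of_lower (t := n - s) (flagOf w s)ᶜ ?_ ?_ (w y)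
  · rw [← this, Finset.mem_compl, mem_flagOf]
    simp
  · intro a ha b hb
    simp only [Finset.mem_compl, mem_flagOf, not_lt] at ha hb
    simpa using h _ _ (not_le.1 hb) ha
  · rw [Finset.card_compl, card_flagOf _ _ hsn, Fintype.card_fin]

lemma descentSet_glue {n s : ℕ} (hsn : s ≤ n) (S : Finset ℕ) (hs : s ∈ insert 0 S)
    (wS : Equiv.Perm (Fin n)) (hwS : descentSet wS = S)
    (hlow : ∀ y : Fin n, (wS y : ℕ) < n - s ↔ s ≤ y)
    (w' : Equiv.Perm (Fin s)) (w : Equiv.Perm (Fin n))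
    (h1 : ∀ (x : ℕ) (h : x < s), (w ⟨x, by omega⟩ : ℕ) = w' ⟨x, h⟩ + (n - s))
    (h2 : ∀ x : Fin n, s ≤ x → w x = wS x) :
    descentSet w = S ↔ descentSet w' = S.filter (fun x => x < s) := by
  have key1 : ∀ i, i + 1 < s → (i + 1 ∈ descentSet w ↔ i + 1 ∈ descentSet w') := by
    intro i hi
    rw [succ_mem_descentSet, succ_mem_descentSet]
    have ha := h1 i (by omega)
    have hb := h1 (i + 1) hi
    constructor
    · rintro ⟨h, hd⟩
      refine ⟨hi, ?_⟩
      rw [Fin.lt_def] at *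
      omega
    · rintro ⟨h, hd⟩
      refine ⟨by omega, ?_⟩
      rw [Fin.lt_def] at *
      omega
  have key2 : ∀ i, s ≤ i + 1 → (i + 1 ∈ descentSet w ↔ i + 1 ∈ S) := by
    intro i hi
    rcases Nat.lt_or_ge i s with h | h
    · have his : i + 1 = s := by omega
      have hsS : i + 1 ∈ S := by
        rcases Finset.mem_insert.1 hs with h' | h'
        · omega
        · rwa [his]
      have hin : i + 1 < n := by
        rw [← hwS, succ_mem_descentSet] at hsS
        exact hsS.1
      refine iff_of_true ?_ hsS
      rw [succ_mem_descentSet]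
      refine ⟨hin, ?_⟩
      rw [h2 ⟨i + 1, hin⟩ (by simpa using hi), Fin.lt_def, h1 i h]
      have := (hlow ⟨i + 1, hin⟩).2 (by simpa using hi)
      omega
    · rw [← hwS, succ_mem_descentSet, succ_mem_descentSet]
      apply exists_congr
      intro hin
      rw [h2 ⟨i + 1, hin⟩ (by simpa using hi), h2 ⟨i, _⟩ (by simpa using h)]
  have key0 : (0 : ℕ) ∉ S := hwS ▸ zero_notMem_descentSet wS
  have key3 : ∀ i, s ≤ i → i ∉ descentSet w' := by
    intro i hi h
    simp only [descentSet, Finset.mem_filter, Finset.mem_Icc] at h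
    omega
  constructor
  · intro h
    ext i
    rcases i with _ | i
    · simp [key0, zero_notMem_descentSet]
    · rw [Finset.mem_filter]
      by_cases hi : i + 1 < s
      · rw [← key1 i hi, h]
        simp [hi]
      · simp [hi, key3 (i + 1) (by omega)]
  · intro h
    ext i
    rcases i with _ | i
    · simp [key0, zero_notMem_descentSet]
    · by_cases hi : i + 1 < s
      · rw [key1 i hi, h, Finset.mem_filter]
        simp [hi]
      · exact key2 i (by omega)

lemma card_agree {n s : ℕ} (hsn : s ≤ n) (S : Finset ℕ) (hs : s ∈ insert 0 S)
    (wS : Equiv.Perm (Fin n)) (hwS : descentSet wS = S)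
    (hlow : ∀ y : Fin n, (wS y : ℕ) < n - s ↔ s ≤ y) :
    Nat.card {w : Equiv.Perm (Fin n) // descentSet w = S ∧
      ∀ x, s < x → x ≤ n → permApp w x = permApp wS x} =
      numDescentSet s (S.filter (fun x => x < s)) := by
  have hagree : ∀ w : Equiv.Perm (Fin n),
      (∀ x, s < x → x ≤ n → permApp w x = permApp wS x) ↔ ∀ x : Fin n, s ≤ x → w x = wS x := by
    intro w
    constructor
    · intro h x hx
      have := h (x + 1) (by omega) (by omega)
      rw [permApp_succ w x x.2, permApp_succ wS x x.2] at this
      exact Fin.ext (by simpa using this)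
    · intro h x hx hxn
      obtain ⟨i, rfl⟩ := Nat.exists_eq_add_of_le' (Nat.one_le_of_lt hx)
      rw [permApp_succ w i (by omega), permApp_succ wS i (by omega),
        h ⟨i, by omega⟩ (by simp; omega)]
  simp only [hagree]
  unfold numDescentSet
  symm
  have hglue : ∀ w' : Equiv.Perm (Fin s), ∃ w : Equiv.Perm (Fin n),
      (∀ (x : ℕ) (h : x < s), (w ⟨x, by omega⟩ : ℕ) = w' ⟨x, h⟩ + (n - s)) ∧
      (∀ x : Fin n, s ≤ x → w x = wS x) := by
    intro w'
    let g : Fin n → Fin n := fun x =>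
      if h : (x : ℕ) < s then ⟨w' ⟨x, h⟩ + (n - s), by have := (w' ⟨x, h⟩).2; omega⟩ else wS x
    have hinj : Function.Injective g := by
      intro x y hxy
      simp only [g] at hxy
      split_ifs at hxy with ha hb hb
      · have := Fin.ext_iff.1 hxy
        simp only at this
        have := w'.injective (Fin.ext (Nat.add_right_cancel this))
        exact Fin.ext (by simpa using this)
      · have := Fin.ext_iff.1 hxy
        simp only at this
        have := (hlow y).2 (by omega)
        omega
      · have := Fin.ext_iff.1 hxy
        simp only at this
        have := (hlow x).2 (by omega)
        omega
      · exact wS.injective hxy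
    refine ⟨Equiv.ofBijective g (Finite.injective_iff_bijective.1 hinj), ?_, ?_⟩
    · intro x h
      simp [g, h]
    · intro x h
      simp [g, not_lt.2 h]
  choose Φ hΦ1 hΦ2 using hglue
  refine Nat.card_eq_of_bijective (fun w' => ⟨Φ w'.1,
    (descentSet_glue hsn S hs wS hwS hlow w'.1 _ (hΦ1 _) (hΦ2 _)).2 w'.2, hΦ2 _⟩) ⟨?_, ?_⟩
  · rintro ⟨a, ha⟩ ⟨b, hb⟩ h
    have h' : Φ a = Φ b := congrArg Subtype.val h
    apply Subtype.ext
    apply Equiv.ext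
    intro x
    have h3 := hΦ1 a x x.2
    have h4 := hΦ1 b x x.2
    rw [h', h4] at h3
    exact Fin.ext (Nat.add_right_cancel h3).symm
  · rintro ⟨w, hw, hw2⟩
    have hge : ∀ x : Fin n, (x : ℕ) < s → n - s ≤ w x := by
      intro x hx
      by_contra hcon
      have h3 := (hlow (wS.symm (w x))).1 (by rw [Equiv.apply_symm_apply]; omega)
      have h4 := hw2 _ h3
      rw [Equiv.apply_symm_apply] at h4
      have := w.injective h4
      rw [this] at h3
      omega
    let g : Fin s → Fin s := fun x => ⟨w ⟨x, by omega⟩ - (n - s), by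
      have := hge ⟨x, by omega⟩ x.2
      have := (w ⟨x, by omega⟩).2
      omega⟩
    have hinj : Function.Injective g := by
      intro x y hxy
      have h3 := Fin.ext_iff.1 hxy
      simp only [g] at h3
      have := hge ⟨x, by omega⟩ x.2
      have := hge ⟨y, by omega⟩ y.2
      have := w.injective (Fin.ext (show (w ⟨x, by omega⟩ : ℕ) = w ⟨y, by omega⟩ by omega))
      exact Fin.ext (by simpa using this)
    let w' := Equiv.ofBijective g (Finite.injective_iff_bijective.1 hinj)
    have hw1 : ∀ (x : ℕ) (h : x < s), (w ⟨x, by omega⟩ : ℕ) = w' ⟨x, h⟩ + (n - s) := by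
      intro x h
      have := hge ⟨x, by omega⟩ h
      simp only [w', Equiv.ofBijective_apply, g]
      omega
    refine ⟨⟨w', (descentSet_glue hsn S hs wS hwS hlow w' w hw1 hw2).1 hw⟩, ?_⟩
    apply Subtype.ext
    apply Equiv.ext
    intro x
    show Φ w' x = w x
    by_cases hx : (x : ℕ) < s
    · apply Fin.ext
      rw [hΦ1 w' x hx, hw1 x hx]
    · rw [hΦ2 w' x (not_lt.1 hx), hw2 x (not_lt.1 hx)]


lemma sElt_succ (n : ℕ) (S : Finset ℕ) (j : ℕ) (h : j < S.card) :
    sElt n S (j + 1) = S.orderEmbOfFin rfl ⟨j, h⟩ := by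
  unfold sElt
  rw [if_neg (by omega), if_pos (by omega), Finset.orderEmbOfFin_apply]
  simp [List.getD_eq_getElem?_getD, h]

lemma sElt_zero (n : ℕ) (S : Finset ℕ) : sElt n S 0 = 0 := by simp [sElt]

lemma sElt_mono (n : ℕ) (S : Finset ℕ) (hS : ∀ s ∈ S, s ≤ n) : Monotone (sElt n S) := by
  apply monotone_nat_of_le_succ
  intro j
  rcases j with _ | j
  · rw [sElt_zero]; exact Nat.zero_le _
  rcases Nat.lt_or_ge (j + 1) S.card with h | h
  · rw [sElt_succ n S j (by omega), sElt_succ n S (j + 1) h]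
    exact (S.orderEmbOfFin rfl).monotone (Fin.le_def.2 (by simp))
  · rw [sElt_of_gt n S (j + 1 + 1) (by omega)]
    rcases Nat.lt_or_ge j S.card with h' | h'
    · rw [sElt_succ n S j h']
      exact hS _ (Finset.orderEmbOfFin_mem _ _ _)
    · rw [sElt_of_gt n S (j + 1) (by omega)]

lemma sElt_card_sub (n : ℕ) (S : Finset ℕ) (hS : ∀ s ∈ S, 0 < s) (s : ℕ)
    (hs : s ∈ insert 0 S) : sElt n S (S.card - (S.filter (fun x => s < x)).card) = s := by
  rcases Finset.mem_insert.1 hs with rfl | hs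
  · rw [Finset.filter_true_of_mem hS, Nat.sub_self, sElt_zero]
  · have : s ∈ Set.range (S.orderEmbOfFin rfl) := by
      rw [Finset.range_orderEmbOfFin]; exact hs
    obtain ⟨j, rfl⟩ := this
    have hc : (S.filter (fun x => S.orderEmbOfFin rfl j < x)).card = S.card - 1 - j := by
      have h1 : S.filter (fun x => S.orderEmbOfFin rfl j < x) =
          (Finset.Ioi j).map (S.orderEmbOfFin rfl).toEmbedding := by
        ext x
        simp only [Finset.mem_filter, Finset.mem_map, Finset.mem_Ioi]
        constructor
        · rintro ⟨hx, hjx⟩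
          have : x ∈ Set.range (S.orderEmbOfFin rfl) := by
            rw [Finset.range_orderEmbOfFin]; exact hx
          obtain ⟨i, rfl⟩ := this
          exact ⟨i, (OrderEmbedding.lt_iff_lt _).1 hjx, rfl⟩
        · rintro ⟨i, hi, rfl⟩
          exact ⟨Finset.orderEmbOfFin_mem _ _ _, (OrderEmbedding.lt_iff_lt _).2 hi⟩
      rw [h1, Finset.card_map, Fin.card_Ioi]
    have hj := j.2
    rw [hc, show S.card - (S.card - 1 - (j : ℕ)) = j + 1 by omega, sElt_succ n S j hj]

/-- Reindexing of a sum over `insert 0 S` by the number of larger elements of `S`. -/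
lemma sum_reindex (n : ℕ) (S : Finset ℕ) (hS : ∀ s ∈ S, 0 < s) (f : ℕ → ℕ → ℤ) :
    ∑ s ∈ insert 0 S, f (S.filter (fun x => s < x)).card s =
      ∑ i ∈ Finset.range (S.card + 1), f i (sElt n S (S.card - i)) := by
  have hinj : Set.InjOn (fun s => (S.filter (fun x => s < x)).card)
      (↑(insert 0 S) : Set ℕ) := by
    intro a ha b hb hab
    simp only at hab
    rw [← sElt_card_sub n S hS a ha, ← sElt_card_sub n S hS b hb, hab]
  have himg : (insert 0 S).image (fun s => (S.filter (fun x => s < x)).card) =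
      Finset.range (S.card + 1) := by
    apply Finset.eq_of_subset_of_card_le
    · intro i hi
      obtain ⟨s, _, rfl⟩ := Finset.mem_image.1 hi
      have := Finset.card_filter_le S (fun x => s < x)
      exact Finset.mem_range.2 (by omega)
    · rw [Finset.card_image_of_injOn hinj, Finset.card_insert_of_notMem, Finset.card_range]
      intro h
      exact lt_irrefl _ (hS 0 h)
  rw [← himg, Finset.sum_image hinj]
  apply Finset.sum_congr rfl
  intro s hs
  rw [sElt_card_sub n S hS s hs]

lemma odd_max_indicator (N : ℕ) (p : ℕ → Prop) (hp : ∀ i j, i ≤ j → p j → p i)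
    (t : ℕ) (htN : t ≤ N) (hpt : p t) (hmax : ∀ i, i ≤ N → p i → i ≤ t) :
    (if Odd t then (1 : ℤ) else 0) =
      ∑ i ∈ Finset.range N, (-1) ^ i * (if p (i + 1) then 1 else 0) := by
  have hiff : ∀ i ∈ Finset.range N, (p (i + 1) ↔ i < t) := by
    intro i hi
    have hi := Finset.mem_range.1 hi
    constructor
    · intro h
      have := hmax (i + 1) (by omega) h
      omega
    · intro h
      exact hp _ _ h hpt
  have h1 : ∑ i ∈ Finset.range N, (-1 : ℤ) ^ i * (if p (i + 1) then 1 else 0) =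
      ∑ i ∈ Finset.range N, if i < t then (-1 : ℤ) ^ i else 0 := by
    apply Finset.sum_congr rfl
    intro i hi
    simp only [hiff i hi, mul_ite, mul_one, mul_zero]
  rw [h1, ← Finset.sum_filter]
  have h2 : (Finset.range N).filter (fun i => i < t) = Finset.range t := by
    ext i
    simp only [Finset.mem_filter, Finset.mem_range]
    omega
  rw [h2, neg_one_geom_sum]
  by_cases h : Even t
  · rw [if_pos h, if_neg (Nat.not_odd_iff_even.2 h)]
  · rw [if_neg h, if_pos (Nat.not_even_iff_odd.1 h)]

lemma card_subtype_eq_sum {α : Type*} [Fintype α] (p : α → Prop) :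
    (Nat.card {a : α // p a} : ℤ) = ∑ a, if p a then 1 else 0 := by
  rw [Nat.card_eq_fintype_card, Fintype.card_subtype]
  simp


/-- **Corollary 4.6(a)**: `b_P(S)` equals the number of pairs `(w,u)` with `w ∈ 𝔖_n` of
descent set `S` and `u` an `r`-colored permutation (a pair of a permutation and a
coloring of its one-line entries) with `τ(w,u)` odd. -/
theorem statement16 (n r : ℕ) (hn : 0 < n) (hr : 0 < r)
    (S : Finset ℕ) (hS : S ⊆ Finset.Icc 1 (n - 1))
    (wS : Equiv.Perm (Fin n)) (hwS : descentSet wS = S)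
    (hwSmax : ∀ v : Equiv.Perm (Fin n), descentSet v = S → invCount v ≤ invCount wS) :
    cChainDim n r S =
      (Nat.card {p : Equiv.Perm (Fin n) × Equiv.Perm (Fin n) × (Fin n → ZMod r) //
          descentSet p.1 = S ∧ Odd (tauU n S wS p.1 p.2.1 p.2.2)} : ℤ) := by
  have : NeZero r := ⟨hr.ne'⟩
  have hpos : ∀ s ∈ S, 0 < s := fun s hs => (Finset.mem_Icc.1 (hS hs)).1
  have hle : ∀ s ∈ S, s ≤ n := fun s hs => by
    have := (Finset.mem_Icc.1 (hS hs)).2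
    omega
  unfold cChainDim
  rw [bDim_formula n r S (fun s hs => ⟨hpos s hs, hle s hs⟩)]
  -- the right-hand side as an alternating sum
  rw [card_subtype_eq_sum]
  have hterm : ∀ p : Equiv.Perm (Fin n) × Equiv.Perm (Fin n) × (Fin n → ZMod r),
      (if descentSet p.1 = S ∧ Odd (tauU n S wS p.1 p.2.1 p.2.2) then (1 : ℤ) else 0) =
      ∑ i ∈ Finset.range (S.card + 1), (-1) ^ i *
        ((if (descentSet p.1 = S ∧ ∀ x, sElt n S (S.card - i) < x → x ≤ n →
          permApp p.1 x = permApp wS x) then 1 else 0) *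
        (if zeroIncreasing p.2.1 p.2.2 (n - sElt n S (S.card - i)) then 1 else 0)) := by
    rintro ⟨w, π, c⟩
    by_cases hw : descentSet w = S
    · simp only [hw, true_and]
      have hmem : tauU n S wS w π c ∈ (Finset.range (S.card + 2)).filter
          (fun i => (∀ x, sElt n S (S.card + 1 - i) < x → x ≤ n → permApp w x = permApp wS x) ∧
            zeroIncreasing π c (n - sElt n S (S.card + 1 - i))) := by
        unfold tauU
        exact Finset.max'_mem _ _
      have hmem := Finset.mem_filter.1 hmem
      have hmax : ∀ i, i ≤ S.card + 1 →
          ((∀ x, sElt n S (S.card + 1 - i) < x → x ≤ n → permApp w x = permApp wS x) ∧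
            zeroIncreasing π c (n - sElt n S (S.card + 1 - i))) → i ≤ tauU n S wS w π c := by
        intro i hi h
        unfold tauU
        exact Finset.le_max' _ _ (Finset.mem_filter.2 ⟨Finset.mem_range.2 (by omega), h⟩)
      have ht : tauU n S wS w π c ≤ S.card + 1 := by
        have := Finset.mem_range.1 hmem.1
        omega
      refine (odd_max_indicator (S.card + 1) (fun i =>
        (∀ x, sElt n S (S.card + 1 - i) < x → x ≤ n → permApp w x = permApp wS x) ∧
            zeroIncreasing π c (n - sElt n S (S.card + 1 - i))) ?_ _ ht hmem.2 hmax).trans ?_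
      · rintro i j hij ⟨ha, hb1, hb2⟩
        have hm : sElt n S (S.card + 1 - j) ≤ sElt n S (S.card + 1 - i) :=
          sElt_mono n S hle (by omega)
        refine ⟨fun x hx hxn => ha x (by omega) hxn,
          fun x y hx hxy hy => hb1 x y hx hxy (by omega), fun k hk => hb2 k (by omega)⟩
      · apply Finset.sum_congr rfl
        intro i _
        simp only [show S.card + 1 - (i + 1) = S.card - i by omega]
        simp only [ite_and, mul_ite, mul_one, mul_zero]
        split_ifs <;> rfl
    · simp [hw]
  refine Eq.trans ?_ (Finset.sum_congr rfl (fun p _ => Eq.trans (by congr) (hterm p))).symm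
  rw [Finset.sum_comm]
  have hprod : ∀ i ∈ Finset.range (S.card + 1),
      (∑ p : Equiv.Perm (Fin n) × Equiv.Perm (Fin n) × (Fin n → ZMod r), (-1 : ℤ) ^ i *
        ((if (descentSet p.1 = S ∧ ∀ x, sElt n S (S.card - i) < x → x ≤ n →
          permApp p.1 x = permApp wS x) then 1 else 0) *
        (if zeroIncreasing p.2.1 p.2.2 (n - sElt n S (S.card - i)) then 1 else 0))) =
      (-1 : ℤ) ^ i * ((Nat.card {w : Equiv.Perm (Fin n) // descentSet w = S ∧
          ∀ x, sElt n S (S.card - i) < x → x ≤ n → permApp w x = permApp wS x} : ℤ) *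
        (Nat.card {u : Equiv.Perm (Fin n) × (Fin n → ZMod r) //
          zeroIncreasing u.1 u.2 (n - sElt n S (S.card - i))} : ℤ)) := by
    intro i _
    rw [card_subtype_eq_sum, card_subtype_eq_sum, ← Finset.mul_sum, Fintype.sum_mul_sum,
      Fintype.sum_prod_type]
    congr! 6
  rw [Finset.sum_congr rfl hprod]
  rw [← sum_reindex n S hpos (fun i s => (-1 : ℤ) ^ i *
      ((Nat.card {w : Equiv.Perm (Fin n) // descentSet w = S ∧
          ∀ x, s < x → x ≤ n → permApp w x = permApp wS x} : ℤ) *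
        (Nat.card {u : Equiv.Perm (Fin n) × (Fin n → ZMod r) //
          zeroIncreasing u.1 u.2 (n - s)} : ℤ)))]
  apply Finset.sum_congr rfl
  intro s hs
  have hsn : s ≤ n := by
    rcases Finset.mem_insert.1 hs with h | h
    · omega
    · exact hle s h
  rw [card_zeroIncreasing n r s hsn, card_agree hsn S hs wS hwS]
  apply low_iff hsn
  intro p q hp hq
  rcases Finset.mem_insert.1 hs with h | h
  · omega
  · exact longest_cross n S hS wS hwS hwSmax p q s h hp hq
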